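/- arXiv:2602.20517 — 3 statements merged into one kernel-verified Lean document; each statement's English description precedes it below -/
import Mathlib

section
/- Fix x₀ ∈ ℝ and a noise schedule β : ℕ → ℝ with 0 < β_t < 1 for all t ≥ 1. Define α_t = 1 − β_t and ᾱ_t = ∏_{i=1}^{t} α_i, and define the marginal laws of the forward diffusion recursively by μ₀ = δ_{x₀} (the Dirac mass at x₀) and μ_t = (pushforward of μ_{t−1} under x ↦ √α_t · x) ∗ gaussianReal 0 β_t. Then for every t ≥ 0, μ_t = gaussianReal (√ᾱ_t · x₀) (1 − ᾱ_t); that is, the forward diffusion process admits the closed-form marginal q(x_t | x₀) = N(√ᾱ_t · x₀, 1 − ᾱ_t). -/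
open MeasureTheory ProbabilityTheory NNReal Finset

/-- **Closed-form marginal of the DDPM forward diffusion.** Fix `x₀ ∈ ℝ` and a noise
schedule `β : ℕ → ℝ≥0` with `0 < β t < 1` for all `t ≥ 1`.  With `α t = 1 − β t` and
`ᾱ t = ∏_{i=1}^{t} α i`, if the marginal laws of the forward diffusion satisfy
`μ 0 = δ_{x₀}` and `μ t = (map (x ↦ √(α t)·x) (μ (t-1))) ∗ N(0, β t)` for `t ≥ 1`, then
`μ t = N(√(ᾱ t)·x₀, 1 − ᾱ t)` for every `t`, i.e. `q(x_t | x₀) = N(√ᾱ_t·x₀, 1 − ᾱ_t)`. -/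
theorem ddpm_forward_closed_form_marginal
    (x₀ : ℝ) (β : ℕ → ℝ≥0) (hβ : ∀ t, 1 ≤ t → 0 < β t ∧ β t < 1)
    (μ : ℕ → Measure ℝ)
    (h0 : μ 0 = Measure.dirac x₀)
    (hrec : ∀ t, 1 ≤ t →
      μ t = Measure.conv
        (Measure.map (fun x : ℝ => Real.sqrt (1 - (β t : ℝ)) * x) (μ (t - 1)))
        (gaussianReal 0 (β t))) :
    ∀ t, μ t
      = gaussianReal (Real.sqrt ((∏ i ∈ Icc 1 t, (1 - β i) : ℝ≥0) : ℝ) * x₀)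
          (1 - ∏ i ∈ Icc 1 t, (1 - β i)) := by
  intro t
  induction t with
  | zero => simp [h0, gaussianReal_zero_var]
  | succ n ih =>
    have hb := (hβ (n + 1) (by omega)).2.le
    have hbR : ((β (n + 1) : ℝ≥0) : ℝ) ≤ 1 := by exact_mod_cast hb
    have hP : ∏ i ∈ Icc 1 n, (1 - β i) ≤ 1 := Finset.prod_le_one' (fun i _ => tsub_le_self)
    rw [hrec (n + 1) (by omega), Nat.add_sub_cancel, ih, gaussianReal_map_const_mul,
      gaussianReal_conv_gaussianReal, Finset.prod_Icc_succ_top (by omega)]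
    generalize ∏ i ∈ Icc 1 n, (1 - β i) = P at *
    have hPb : P * (1 - β (n + 1)) ≤ 1 := mul_le_one' hP tsub_le_self
    congr 1
    · rw [NNReal.coe_mul, NNReal.coe_sub hb, Real.sqrt_mul P.coe_nonneg, NNReal.coe_one]
      ring
    · apply NNReal.coe_injective
      rw [NNReal.coe_add, NNReal.coe_mul, NNReal.coe_sub hPb, NNReal.coe_sub hP, NNReal.coe_mul,
        NNReal.coe_sub hb, NNReal.coe_mk, Real.sq_sqrt (by linarith), NNReal.coe_one]
      ring
end

section
/- (One-dimensional Gaussian Bayes rule.) Let m₀ ∈ ℝ, v₀ > 0, v > 0 and a ∈ ℝ. Let μ be the joint probability measure on ℝ × ℝ of a pair (X, Y) where X ~ gaussianReal m₀ v₀ and, conditionally on X = x, Y ~ gaussianReal (a·x) v; i.e., μ is the composition-product of gaussianReal m₀ v₀ with the Markov kernel x ↦ gaussianReal (a·x) v. Then the pushforward of μ under the swap (x,y) ↦ (y,x) equals the composition-product of gaussianReal (a·m₀) (a²·v₀ + v) with the Markov kernel y ↦ gaussianReal ((v·m₀ + a·v₀·y)/(a²·v₀ + v)) (v₀·v/(a²·v₀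 + v)). In particular Y ~ N(a·m₀, a²·v₀ + v), and the conditional law of X given Y = y is Gaussian with mean (v·m₀ + a·v₀·y)/(a²·v₀ + v) and variance v₀·v/(a²·v₀ + v). -/
open MeasureTheory ProbabilityTheory NNReal

lemma gaussian_compProd_lintegral (m : ℝ) (s w : ℝ≥0) (hs : s ≠ 0) (hw : w ≠ 0)
    (g : ℝ → ℝ) (κ : Kernel ℝ ℝ) [IsMarkovKernel κ]
    (hκ : ∀ x, κ x = gaussianReal (g x) w)
    (f : ℝ × ℝ → ENNReal) (hf : Measurable f) :
    ∫⁻ p, f p ∂(gaussianReal m s ⊗ₘ κ)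
      = ∫⁻ x, ∫⁻ y, gaussianPDF m s x * gaussianPDF (g x) w y * f (x, y) := by
  rw [Measure.lintegral_compProd hf, gaussianReal_of_var_ne_zero m hs,
    lintegral_withDensity_eq_lintegral_mul _ (measurable_gaussianPDF m s)
      (hf.lintegral_kernel_prod_right' (κ := κ))]
  refine lintegral_congr fun x => ?_
  have hfx : Measurable fun y => f (x, y) := hf.comp measurable_prodMk_left
  rw [Pi.mul_apply, hκ, gaussianReal_of_var_ne_zero _ hw,
    lintegral_withDensity_eq_lintegral_mul _ (measurable_gaussianPDF _ w) hfx,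
    ← lintegral_const_mul _ ((measurable_gaussianPDF _ w).mul hfx)]
  simp only [Pi.mul_apply, mul_assoc]

lemma gaussianPDF_bayes (m₀ : ℝ) (v₀ v : ℝ≥0) (hv₀ : 0 < v₀) (hv : 0 < v) (a x y : ℝ) :
    gaussianPDF m₀ v₀ x * gaussianPDF (a * x) v y
      = gaussianPDF (a * m₀) (Real.toNNReal (a ^ 2) * v₀ + v) y
        * gaussianPDF (((v : ℝ) * m₀ + a * (v₀ : ℝ) * y) / (a ^ 2 * (v₀ : ℝ) + (v : ℝ)))
        (v₀ * v / (Real.toNNReal (a ^ 2) * v₀ + v)) x := by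
  simp only [gaussianPDF]
  rw [← ENNReal.ofReal_mul (gaussianPDFReal_nonneg _ _ _),
    ← ENNReal.ofReal_mul (gaussianPDFReal_nonneg _ _ _)]
  congr 1
  simp only [gaussianPDFReal, NNReal.coe_div, NNReal.coe_mul, NNReal.coe_add,
    Real.coe_toNNReal _ (sq_nonneg a)]
  have h0 : (0 : ℝ) < v₀ := hv₀
  have h1 : (0 : ℝ) < v := hv
  generalize (v₀ : ℝ) = s at *
  generalize (v : ℝ) = w at *
  have hS : 0 < a ^ 2 * s + w := by positivity
  rw [mul_mul_mul_comm, mul_mul_mul_comm (√(2 * Real.pi * (a ^ 2 * s + w)))⁻¹,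
    ← Real.exp_add, ← Real.exp_add, ← mul_inv, ← mul_inv,
    ← Real.sqrt_mul (by positivity), ← Real.sqrt_mul (by positivity)]
  congr 1
  · congr 2
    field_simp
  · congr 1
    field_simp
    ring

theorem gaussian_bayes_rule
    (m₀ : ℝ) (v₀ v : ℝ≥0) (hv₀ : 0 < v₀) (hv : 0 < v) (a : ℝ)
    (κ : Kernel ℝ ℝ) [IsMarkovKernel κ]
    (hκ : ∀ x : ℝ, κ x = gaussianReal (a * x) v)
    (ξ : Kernel ℝ ℝ) [IsMarkovKernel ξ]
    (hξ : ∀ y : ℝ,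
      ξ y = gaussianReal
        (((v : ℝ) * m₀ + a * (v₀ : ℝ) * y) / (a ^ 2 * (v₀ : ℝ) + (v : ℝ)))
        (v₀ * v / (Real.toNNReal (a ^ 2) * v₀ + v))) :
    Measure.map Prod.swap (gaussianReal m₀ v₀ ⊗ₘ κ)
      = gaussianReal (a * m₀) (Real.toNNReal (a ^ 2) * v₀ + v) ⊗ₘ ξ := by
  refine Measure.ext_of_lintegral _ fun f hf => ?_
  have hS : Real.toNNReal (a ^ 2) * v₀ + v ≠ 0 := by positivity
  have hT : v₀ * v / (Real.toNNReal (a ^ 2) * v₀ + v) ≠ 0 := by positivity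
  rw [lintegral_map hf measurable_swap,
    gaussian_compProd_lintegral m₀ v₀ v hv₀.ne' hv.ne' (fun x => a * x) κ hκ
      (fun p => f p.swap) (hf.comp measurable_swap),
    gaussian_compProd_lintegral _ _ _ hS hT
      (fun y => ((v : ℝ) * m₀ + a * (v₀ : ℝ) * y) / (a ^ 2 * (v₀ : ℝ) + (v : ℝ)))
      ξ hξ f hf, lintegral_lintegral_swap]
  · simp only [Prod.swap_prod_mk, gaussianPDF_bayes m₀ v₀ v hv₀ hv a]
  · apply Measurable.aemeasurable
    have h1 : Measurable fun p : ℝ × ℝ => gaussianPDF m₀ v₀ p.1 :=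
      (measurable_gaussianPDF m₀ v₀).comp measurable_fst
    have h2 : Measurable fun p : ℝ × ℝ => gaussianPDF (a * p.1) v p.2 :=
      measurable_uncurry_gaussianPDF.comp
        (f := fun p : ℝ × ℝ => (a * p.1, v, p.2)) (by fun_prop)
    exact (h1.mul h2).mul (hf.comp measurable_swap)
end

section
/- (DDPM forward-process posterior.) Let t ≥ 1, 0 < β_t < 1, set α_t = 1 − β_t, let ᾱ_{t−1} ∈ (0,1) and ᾱ_t = ᾱ_{t−1}·α_t, and fix x₀ ∈ ℝ. Consider the joint law of (x_{t−1}, x_t) given x₀, where x_{t−1} ~ gaussianReal (√ᾱ_{t−1}·x₀) (1 − ᾱ_{t−1}) and, conditionally on x_{t−1}, x_t ~ gaussianReal (√α_t·x_{t−1}) β_t. Then: (i) marginally x_t ~ gaussianReal (√ᾱ_t·x₀) (1 − ᾱ_t); and (ii) the conditional law of x_{t−1} given x_t is Gaussian with mean (√ᾱ_{t−1}·β_t·x₀ + √α_t·(1 − ᾱ_{t−1})·x_t)/(1 − ᾱ_t) and variance β̃_t = ((1 − ᾱ_{t−1})/(1 − ᾱ_t))·β_t. In kernel form: the swap of the joint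 measure factorizes as gaussianReal (√ᾱ_t·x₀) (1−ᾱ_t) composed with the Markov kernel x_t ↦ gaussianReal of the stated posterior mean and variance β̃_t. -/
open MeasureTheory ProbabilityTheory NNReal

lemma gauss_pdf_bayes (a m : ℝ) (v b w u : ℝ≥0) (hv : v ≠ 0) (hb : b ≠ 0)
    (hw : (w : ℝ) = a ^ 2 * v + b) (hu : (u : ℝ) = v / w * b) (x y : ℝ) :
    gaussianPDFReal m v x * gaussianPDFReal (a * x) b y
      = gaussianPDFReal (a * m) w y * gaussianPDFReal ((b * m + a * v * y) / w) u x := by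
  have hv' : (0 : ℝ) < v := by positivity
  have hb' : (0 : ℝ) < b := by positivity
  have hw' : (0 : ℝ) < w := by rw [hw]; positivity
  have hu' : (0 : ℝ) < u := by rw [hu]; positivity
  have h1 : (√(2 * Real.pi * v))⁻¹ * (√(2 * Real.pi * b))⁻¹
      = (√(2 * Real.pi * w))⁻¹ * (√(2 * Real.pi * u))⁻¹ := by
    rw [← mul_inv, ← mul_inv, ← Real.sqrt_mul (by positivity), ← Real.sqrt_mul (by positivity), hu]
    congr 2
    field_simp
  have h2 : -(x - m) ^ 2 / (2 * v) + -(y - a * x) ^ 2 / (2 * b)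
      = -(y - a * m) ^ 2 / (2 * w) + -(x - (b * m + a * v * y) / w) ^ 2 / (2 * u) := by
    rw [hu]
    rw [hw] at hw' ⊢
    have := hw'.ne'
    field_simp
    ring
  simp only [gaussianPDFReal]
  rw [mul_mul_mul_comm, mul_mul_mul_comm (√(2 * Real.pi * w))⁻¹, ← Real.exp_add, ← Real.exp_add, h1, h2]

lemma gauss_bayes (a m : ℝ) (v b w u : ℝ≥0) (hv : v ≠ 0) (hb : b ≠ 0)
    (hw : (w : ℝ) = a ^ 2 * v + b) (hu : (u : ℝ) = v / w * b)
    (κ ξ : Kernel ℝ ℝ) [IsMarkovKernel κ] [IsMarkovKernel ξ]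
    (hκ : ∀ x, κ x = gaussianReal (a * x) b)
    (hξ : ∀ y, ξ y = gaussianReal ((b * m + a * v * y) / w) u) :
    Measure.map Prod.swap (gaussianReal m v ⊗ₘ κ) = gaussianReal (a * m) w ⊗ₘ ξ := by
  have hv' : (0 : ℝ) < v := by positivity
  have hb' : (0 : ℝ) < b := by positivity
  have hw' : (0 : ℝ) < w := by rw [hw]; positivity
  have hu' : (0 : ℝ) < u := by rw [hu]; positivity
  have hw0 : w ≠ 0 := by rintro rfl; simp at hw'
  have hu0 : u ≠ 0 := by rintro rfl; simp at hu'
  have hm1 : Measurable (fun p : ℝ × ℝ => gaussianPDF (a * p.1) b p.2) :=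
    measurable_uncurry_gaussianPDF.comp
      (f := fun p : ℝ × ℝ => (a * p.1, b, p.2)) (by fun_prop)
  have hm2 : Measurable (fun p : ℝ × ℝ => gaussianPDF ((b * m + a * v * p.1) / w) u p.2) :=
    measurable_uncurry_gaussianPDF.comp
      (f := fun p : ℝ × ℝ => ((b * m + a * v * p.1) / w, u, p.2)) (by fun_prop)
  have hgm := measurable_gaussianPDF m v
  have hgw := measurable_gaussianPDF (a * m) w
  refine Measure.ext_of_lintegral _ fun f hf => ?_
  rw [lintegral_map hf measurable_swap,
    Measure.lintegral_compProd (f := fun p => f p.swap) (hf.comp measurable_swap), Measure.lintegral_compProd hf]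
  simp only [hκ, hξ, gaussianReal_of_var_ne_zero _ hv, gaussianReal_of_var_ne_zero _ hb,
    gaussianReal_of_var_ne_zero _ hw0, gaussianReal_of_var_ne_zero _ hu0]
  have e1 : ∀ x, ∫⁻ y, f (Prod.swap (x, y)) ∂(volume.withDensity (gaussianPDF (a * x) b))
      = ∫⁻ y, gaussianPDF (a * x) b y * f (y, x) := fun x => by
    rw [lintegral_withDensity_eq_lintegral_mul _ (measurable_gaussianPDF _ _)
      (by simp only [Prod.swap_prod_mk]; fun_prop)]
    rfl
  have e2 : ∀ y, ∫⁻ x, f (y, x)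
        ∂(volume.withDensity (gaussianPDF ((b * m + a * v * y) / w) u))
      = ∫⁻ x, gaussianPDF ((b * m + a * v * y) / w) u x * f (y, x) := fun y => by
    rw [lintegral_withDensity_eq_lintegral_mul _ (measurable_gaussianPDF _ _) (by fun_prop)]
    rfl
  simp only [e1, e2]
  have hF1 : Measurable (fun p : ℝ × ℝ => gaussianPDF (a * p.1) b p.2 * f (p.2, p.1)) :=
    hm1.mul (by fun_prop)
  have hF2 : Measurable
      (fun p : ℝ × ℝ => gaussianPDF ((b * m + a * v * p.1) / w) u p.2 * f (p.1, p.2)) :=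
    hm2.mul (by fun_prop)
  rw [lintegral_withDensity_eq_lintegral_mul _ hgm hF1.lintegral_prod_right',
    lintegral_withDensity_eq_lintegral_mul _ hgw hF2.lintegral_prod_right']
  simp only [Pi.mul_apply]
  have e3 : ∀ x, gaussianPDF m v x * ∫⁻ y, gaussianPDF (a * x) b y * f (y, x)
      = ∫⁻ y, gaussianPDF m v x * (gaussianPDF (a * x) b y * f (y, x)) := fun x =>
    (lintegral_const_mul _ (hF1.comp (measurable_prodMk_left (x := x)))).symm
  have e4 : ∀ y, gaussianPDF (a * m) w y *
        ∫⁻ x, gaussianPDF ((b * m + a * v * y) / w) u x * f (y, x)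
      = ∫⁻ x, gaussianPDF (a * m) w y *
        (gaussianPDF ((b * m + a * v * y) / w) u x * f (y, x)) := fun y =>
    (lintegral_const_mul _ (hF2.comp (measurable_prodMk_left (x := y)))).symm
  simp only [e3, e4]
  rw [lintegral_lintegral_swap ((hgm.comp measurable_fst).mul hF1).aemeasurable]
  refine lintegral_congr fun y => lintegral_congr fun x => ?_
  rw [← mul_assoc, ← mul_assoc]
  congr 1
  simp only [gaussianPDF]
  rw [← ENNReal.ofReal_mul (gaussianPDFReal_nonneg _ _ _),
    ← ENNReal.ofReal_mul (gaussianPDFReal_nonneg _ _ _),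
    gauss_pdf_bayes a m v b w u hv hb hw hu]

/-- **DDPM forward-process posterior.** Let `t ≥ 1`, `0 < β_t < 1`, `α_t = 1 − β_t`,
`ᾱ_{t−1} ∈ (0,1)`, `ᾱ_t = ᾱ_{t−1}·α_t`, and fix `x₀ ∈ ℝ`.  For the joint law of
`(x_{t−1}, x_t)` given `x₀`, where `x_{t−1} ~ N(√ᾱ_{t−1}·x₀, 1 − ᾱ_{t−1})` and,
conditionally, `x_t ~ N(√α_t·x_{t−1}, β_t)`:
(i) marginally `x_t ~ N(√ᾱ_t·x₀, 1 − ᾱ_t)`; and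
(ii) the swapped joint law factorizes through the Gaussian posterior kernel with mean
`(√ᾱ_{t−1}·β_t·x₀ + √α_t·(1 − ᾱ_{t−1})·x_t)/(1 − ᾱ_t)` and variance
`β̃_t = ((1 − ᾱ_{t−1})/(1 − ᾱ_t))·β_t`. -/
theorem ddpm_forward_process_posterior
    (t : ℕ) (ht : 1 ≤ t) (β : ℝ≥0) (hβ0 : 0 < β) (hβ1 : β < 1)
    (αbarPrev : ℝ≥0) (hp0 : 0 < αbarPrev) (hp1 : αbarPrev < 1) (x₀ : ℝ)
    (κ : Kernel ℝ ℝ) [IsMarkovKernel κ]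
    (hκ : ∀ x : ℝ, κ x = gaussianReal (Real.sqrt ((1 - β : ℝ≥0) : ℝ) * x) β)
    (ξ : Kernel ℝ ℝ) [IsMarkovKernel ξ]
    (hξ : ∀ xt : ℝ,
      ξ xt = gaussianReal
        ((Real.sqrt (αbarPrev : ℝ) * (β : ℝ) * x₀
            + Real.sqrt ((1 - β : ℝ≥0) : ℝ) * (1 - (αbarPrev : ℝ)) * xt)
          / (1 - (αbarPrev * (1 - β) : ℝ≥0) : ℝ))
        (((1 - αbarPrev) / (1 - αbarPrev * (1 - β))) * β)) :
    Measure.map Prod.snd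
        (gaussianReal (Real.sqrt (αbarPrev : ℝ) * x₀) (1 - αbarPrev) ⊗ₘ κ)
      = gaussianReal (Real.sqrt ((αbarPrev * (1 - β) : ℝ≥0) : ℝ) * x₀)
          (1 - αbarPrev * (1 - β)) ∧
    Measure.map Prod.swap
        (gaussianReal (Real.sqrt (αbarPrev : ℝ) * x₀) (1 - αbarPrev) ⊗ₘ κ)
      = gaussianReal (Real.sqrt ((αbarPrev * (1 - β) : ℝ≥0) : ℝ) * x₀)
          (1 - αbarPrev * (1 - β)) ⊗ₘ ξ := by
  have hc : ((1 - β : ℝ≥0) : ℝ) = 1 - β := NNReal.coe_sub hβ1.le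
  have hp : ((1 - αbarPrev : ℝ≥0) : ℝ) = 1 - αbarPrev := NNReal.coe_sub hp1.le
  have hle : αbarPrev * (1 - β) ≤ 1 := mul_le_one' hp1.le tsub_le_self
  have hw : ((1 - αbarPrev * (1 - β) : ℝ≥0) : ℝ) = 1 - αbarPrev * (1 - β) := by
    rw [NNReal.coe_sub hle]; simp [hc]
  have hβ1' : (β : ℝ) < 1 := by exact_mod_cast hβ1
  have hm : √((αbarPrev * (1 - β) : ℝ≥0) : ℝ) * x₀
      = √((1 - β : ℝ≥0) : ℝ) * (√(αbarPrev : ℝ) * x₀) := by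
    rw [NNReal.coe_mul, Real.sqrt_mul (NNReal.coe_nonneg _)]; ring
  have key : Measure.map Prod.swap
        (gaussianReal (Real.sqrt (αbarPrev : ℝ) * x₀) (1 - αbarPrev) ⊗ₘ κ)
      = gaussianReal (Real.sqrt ((αbarPrev * (1 - β) : ℝ≥0) : ℝ) * x₀)
          (1 - αbarPrev * (1 - β)) ⊗ₘ ξ := by
    rw [hm]
    refine gauss_bayes _ _ _ β _ (((1 - αbarPrev) / (1 - αbarPrev * (1 - β))) * β)
      (tsub_pos_of_lt hp1).ne' hβ0.ne' ?_ ?_ κ ξ hκ ?_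
    · rw [Real.sq_sqrt (NNReal.coe_nonneg _), hw, hc, hp]; ring
    · push_cast; rfl
    · intro y
      rw [hξ y]
      congr 1
      rw [hw, hp, NNReal.coe_mul, hc]
      congr 1
      ring
  refine ⟨?_, key⟩
  have h := congrArg Measure.fst key
  rw [Measure.fst_compProd, Measure.fst_map_swap] at h
  exact h
end
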